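/- Let I be the interpreted system of the Counting FloodSet with perfect recall information exchange E^{count(pr)} under Crash_t, let r be a run of I and m a time, and suppose agent i's local state at (r,m) is r_i(m) = ⟨W, h, m, v_i⟩, where h is the vector of per-round missing-message counts. Then (I,r,m) ⊨ C_N(∃0) ∨ C_N(∃1) if and only if m ≥ min{t+1, n−1} or there exists k with 1 ≤ k ≤ m such that h[k] ≥ n−1. -/

import Mathlib

namespace SBA

/-- The set of values `{0,1}`; `false` plays the role of `0`, `true` of `1`. -/
abbrev Values := Bool

/-- Actions of an agent in the SBA problem: decide a value, or do nothing. -/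
inductive Action where
  | decide (v : Values)
  | noop
deriving DecidableEq

/-- An adversary: `F m i j = false` means agent `i`'s round-`m` message to `j`
is not delivered. -/
structure Adversary (n : ℕ) where
  F : ℕ → Fin n → Fin n → Bool

/-- Validity of an adversary for the crash failure model `Crash_t`:
crashes are permanent, an undelivered message means the sender has crashed,
and at most `t` agents are faulty. -/
def Adversary.Valid {n : ℕ} (A : Adversary n) (t : ℕ) : Prop :=
  (∀ m i, A.F m i i = false → ∀ m', m < m' → ∀ k, A.F m' i k = false) ∧
  (∀ m i j, A.F m i j = false → A.F m i i = false) ∧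
  {i : Fin n | ∃ m j, A.F m i j = false}.ncard ≤ t

/-- An information exchange: local state types, message types, the special
`crashed` state, a (bijective) choice of initial state for each initial value,
the message selection function `μ` and the state update function `δ`. -/
structure InfoExchange (n : ℕ) where
  L : Fin n → Type
  M : Fin n → Type
  crashSt : ∀ i, L i
  initSt : ∀ i, Values → L i
  initInj : ∀ i, Function.Injective (initSt i)
  μ : ∀ i, L i → Action → (Fin n → Option (M i))
  δ : ∀ i, L i → Adversary n → Action → ((j : Fin n) → Option (M j)) → L i

/-- A decision protocol for information exchange `E`: each agent maps its
local state to an action. -/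
def DecProtocol {n : ℕ} (E : InfoExchange n) := ∀ i : Fin n, E.L i → Action

/-- A run: a (constant) environment state (the adversary) together with, for
each time, a local state for each agent. -/
structure Run {n : ℕ} (E : InfoExchange n) where
  env : Adversary n
  st : ℕ → (i : Fin n) → E.L i

/-- The vector of messages received by agent `i` in round `k+1`. -/
def recvd {n : ℕ} (E : InfoExchange n) (P : DecProtocol E) (r : Run E) (k : ℕ)
    (i : Fin n) : (j : Fin n) → Option (E.M j) :=
  fun j => if r.env.F (k+1) j i = true
           then E.μ j (r.st k j) (P j (r.st k j)) i else none

/-- Agent `i` has not been crashed by the adversary up to (and including) round `m`. -/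
def aliveAt {n : ℕ} (A : Adversary n) (m : ℕ) (i : Fin n) : Prop :=
  ∀ k ≤ m, A.F k i i = true

instance {n : ℕ} (A : Adversary n) (m : ℕ) (i : Fin n) : Decidable (aliveAt A m i) := by
  unfold aliveAt; infer_instance

/-- `r` is a run generated by decision protocol `P` with information exchange `E`
in the crash failure context `Crash_t`. -/
def IsRun {n : ℕ} (E : InfoExchange n) (P : DecProtocol E) (t : ℕ) (r : Run E) : Prop :=
  r.env.Valid t ∧
  (∀ i, ∃ v, r.st 0 i = E.initSt i v) ∧
  ∀ k i, r.st (k+1) i =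
    if aliveAt r.env (k+1) i
    then E.δ i (r.st k i) r.env (P i (r.st k i)) (recvd E P r k i)
    else E.crashSt i

/-- The interpreted system `I_{P,E,Crash_t}`: the set of runs of `(P,E)` in `Crash_t`. -/
def Runs {n : ℕ} (E : InfoExchange n) (P : DecProtocol E) (t : ℕ) : Set (Run E) :=
  {r | IsRun E P t r}

/-- Agent `i` is nonfailed at the point `(r,m)`, i.e. `i ∈ N(r,m)`. -/
def Nonfailed {n : ℕ} (E : InfoExchange n) (r : Run E) (m : ℕ) (i : Fin n) : Prop :=
  r.st m i ≠ E.crashSt i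

/-- (Semantic) formulas: predicates on points. -/
abbrev Form {n : ℕ} (E : InfoExchange n) := Run E → ℕ → Prop

/-- Knowledge: `K_i φ` holds at `(r,m)` iff `φ` holds at every point of the
system `R` that is indistinguishable to agent `i` from `(r,m)`. -/
def Kn {n : ℕ} (E : InfoExchange n) (R : Set (Run E)) (i : Fin n) (φ : Form E) : Form E :=
  fun r m => ∀ r' ∈ R, ∀ m', r.st m i = r'.st m' i → φ r' m'

/-- `E_N φ`: every nonfailed agent knows `φ`. -/
def EvK {n : ℕ} (E : InfoExchange n) (R : Set (Run E)) (φ : Form E) : Form E :=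
  fun r m => ∀ i, Nonfailed E r m i → Kn E R i φ r m

/-- Common knowledge among the nonfailed agents: `E_N^k φ` for all `k ≥ 1`. -/
def CK {n : ℕ} (E : InfoExchange n) (R : Set (Run E)) (φ : Form E) : Form E :=
  fun r m => ∀ k : ℕ, (EvK E R)^[k+1] φ r m

/-- The atomic proposition `∃v`: some agent has initial value `v` in the run. -/
def ExistsVal {n : ℕ} (E : InfoExchange n) (v : Values) : Form E :=
  fun r _m => ∃ i, r.st 0 i = E.initSt i v

/-- Two runs (of possibly different information exchanges) correspond: same
adversary and the same initial values for all agents. -/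
def Corresponds {n : ℕ} (E1 E2 : InfoExchange n) (r1 : Run E1) (r2 : Run E2) : Prop :=
  r1.env = r2.env ∧ ∀ i, ∃ v, r1.st 0 i = E1.initSt i v ∧ r2.st 0 i = E2.initSt i v

/-- Agreement: nonfailed agents decide the same value. -/
def Agreement {n : ℕ} (E : InfoExchange n) (P : DecProtocol E) (t : ℕ) : Prop :=
  ∀ r ∈ Runs E P t, ∀ (m m' : ℕ) (i j : Fin n) (v v' : Values),
    Nonfailed E r m i → Nonfailed E r m' j →
    P i (r.st m i) = Action.decide v → P j (r.st m' j) = Action.decide v' → v = v'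

/-- Validity: any value decided by a nonfailed agent is some agent's initial value. -/
def ValidityP {n : ℕ} (E : InfoExchange n) (P : DecProtocol E) (t : ℕ) : Prop :=
  ∀ r ∈ Runs E P t, ∀ (m : ℕ) (i : Fin n) (v : Values),
    Nonfailed E r m i → P i (r.st m i) = Action.decide v →
    ∃ j, r.st 0 j = E.initSt j v

/-- Simultaneity: if a nonfailed agent decides in a round, every nonfailed agent
decides in that round. -/
def Simultaneity {n : ℕ} (E : InfoExchange n) (P : DecProtocol E) (t : ℕ) : Prop :=
  ∀ r ∈ Runs E P t, ∀ (m : ℕ) (i j : Fin n) (v : Values),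
    Nonfailed E r m i → Nonfailed E r m j →
    P i (r.st m i) = Action.decide v → ∃ w, P j (r.st m j) = Action.decide w

/-- Termination: every agent eventually decides or fails. -/
def TerminationP {n : ℕ} (E : InfoExchange n) (P : DecProtocol E) (t : ℕ) : Prop :=
  ∀ r ∈ Runs E P t, ∀ i : Fin n,
    (∃ m, ¬ Nonfailed E r m i) ∨ (∃ m v, P i (r.st m i) = Action.decide v)

/-- `(P,E)` is an SBA protocol in the crash failure context `Crash_t`. -/
def IsSBA {n : ℕ} (E : InfoExchange n) (P : DecProtocol E) (t : ℕ) : Prop :=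
  Agreement E P t ∧ ValidityP E P t ∧ Simultaneity E P t ∧ TerminationP E P t

/-- `E` does not transmit information about actions. -/
def NoActionInfo {n : ℕ} (E : InfoExchange n) : Prop :=
  ∀ (i : Fin n) (s : E.L i) (a₁ a₂ : Action),
    E.μ i s a₁ = E.μ i s a₂ ∧ ∀ A v, E.δ i s A a₁ v = E.δ i s A a₂ v

/-- The trivial decision protocol (used to form `I_E` for an information exchange
that does not transmit information about actions). -/
def noopProt {n : ℕ} (E : InfoExchange n) : DecProtocol E := fun _ _ => Action.noop

/-- The interpreted system `I_E` of an information exchange that does not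
transmit information about actions. -/
def Sys {n : ℕ} (E : InfoExchange n) (t : ℕ) : Set (Run E) :=
  Runs E (noopProt E) t

end SBA
namespace SBA

/-- The number of agents from which no message was received. -/
def missingCount {n : ℕ} {M : Fin n → Type} (ms : (j : Fin n) → Option (M j)) : ℕ :=
  (Finset.univ.filter (fun j => (ms j).isNone)).card

/-- Local states of the Counting FloodSet information exchange `E^count`. -/
inductive CountState where
  | crashed
  | live (W : Finset Bool) (h : ℕ) (m : ℕ) (v : Bool)
deriving DecidableEq

/-- The Counting FloodSet information exchange `E^count`. -/
def countE (n : ℕ) : InfoExchange n where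
  L := fun _ => CountState
  M := fun _ => Finset Bool
  crashSt := fun _ => .crashed
  initSt := fun _ v => .live {v} 0 0 v
  initInj := by
    intro i v v' h
    injection h with h1 h2 h3 h4
  μ := fun _ s _ => match s with
    | .crashed => fun _ => none
    | .live W _ _ _ => fun _ => some W
  δ := fun _ s _ _ ms => match s with
    | .crashed => .crashed
    | .live W _ m v =>
        .live (W ∪ Finset.univ.biUnion (fun j => (ms j).getD ∅))
          (missingCount ms) (m+1) v

end SBA
namespace SBA

/-- Local states of the Counting FloodSet with perfect recall exchange `E^count(pr)`. -/
inductive CountPRState where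
  | crashed
  | live (W : Finset Bool) (h : List ℕ) (m : ℕ) (v : Bool)
deriving DecidableEq

/-- The Counting FloodSet with perfect recall information exchange `E^count(pr)`. -/
def countPRE (n : ℕ) : InfoExchange n where
  L := fun _ => CountPRState
  M := fun _ => Finset Bool
  crashSt := fun _ => .crashed
  initSt := fun _ v => .live {v} [0] 0 v
  initInj := by
    intro i v v' h
    injection h with h1 h2 h3 h4
  μ := fun _ s _ => match s with
    | .crashed => fun _ => none
    | .live W _ _ _ => fun _ => some W
  δ := fun _ s _ _ ms => match s with
    | .crashed => .crashed
    | .live W h m v =>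
        .live (W ∪ Finset.univ.biUnion (fun j => (ms j).getD ∅))
          (h ++ [missingCount ms]) (m+1) v

end SBA
namespace SBA

section

open Finset

variable {n : ℕ}

/-- Agent `i` is nonfailed at time `m`; nobody counts as failed at time `0`. -/
def Up (A : Adversary n) (m : ℕ) (i : Fin n) : Prop := m = 0 ∨ aliveAt A m i

instance (A : Adversary n) (m : ℕ) (i : Fin n) : Decidable (Up A m i) := by
  unfold Up; infer_instance

/-- The number of agents whose round-`k` message is not delivered to `i`. -/
def miss (A : Adversary n) (k : ℕ) (i : Fin n) : ℕ :=
  #{j | A.F k j i = false}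

/-- The values seen by agent `i` up to a given time, for initial values `f`. -/
def seen (A : Adversary n) (f : Fin n → Bool) : ℕ → Fin n → Finset Bool
  | 0, i => {f i}
  | k + 1, i => seen A f k i ∪
      univ.biUnion fun j => if A.F (k + 1) j i = true then seen A f k j else ∅

/-- The vector of missing-message counts of agent `i`. -/
def hist (A : Adversary n) (i : Fin n) : ℕ → List ℕ
  | 0 => [0]
  | k + 1 => hist A i k ++ [miss A (k + 1) i]

/-- The local states determined by an adversary and initial values. -/
def stateOf (A : Adversary n) (f : Fin n → Bool) (m : ℕ) (i : Fin n) : CountPRState :=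
  if Up A m i then .live (seen A f m i) (hist A i m) m (f i) else .crashed

/-- The run determined by an adversary and initial values. -/
def runOf (A : Adversary n) (f : Fin n → Bool) : Run (countPRE n) where
  env := A
  st := stateOf A f

/-! ### Adversaries -/

theorem aliveAt.mono {A : Adversary n} {k m : ℕ} {i : Fin n} (h : aliveAt A m i) (hk : k ≤ m) :
    aliveAt A k i := fun l hl => h l (hl.trans hk)

theorem Adversary.Valid.aliveAt_of_deliver {A : Adversary n} {t : ℕ} (hA : A.Valid t) {k : ℕ}
    {j i : Fin n} (h : A.F (k + 1) j i = true) : aliveAt A k j := by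
  intro l hl
  by_contra hc
  have := hA.1 l j (by simpa using hc) (k + 1) (by omega) i
  simp [this] at h

theorem Adversary.Valid.deliver_of_aliveAt {A : Adversary n} {t : ℕ} (hA : A.Valid t) {k : ℕ}
    {j : Fin n} (h : aliveAt A k j) (i : Fin n) : A.F k j i = true := by
  by_contra hc
  have := hA.2.1 k j i (by simpa using hc)
  simp [h k le_rfl] at this

theorem miss_mono {A : Adversary n} {t : ℕ} (hA : A.Valid t) (i : Fin n) :
    Monotone fun k => miss A k i := by
  refine monotone_nat_of_le_succ fun k => card_le_card fun j hj => ?_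
  simp only [mem_filter, mem_univ, true_and] at hj ⊢
  exact hA.1 k j (hA.2.1 k j i hj) _ (by omega) i

theorem miss_le {A : Adversary n} {t : ℕ} (hA : A.Valid t) (k : ℕ) (i : Fin n) :
    miss A k i ≤ t := by
  refine le_trans ?_ hA.2.2
  rw [miss, ← Set.ncard_coe_finset]
  refine Set.ncard_le_ncard ?_ (Set.toFinite _)
  intro j hj
  exact ⟨k, i, by simpa using hj⟩

theorem getD_hist (A : Adversary n) (i : Fin n) {k m : ℕ} (h1 : 1 ≤ k) (hk : k ≤ m) :
    (hist A i m).getD k 0 = miss A k i := by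
  have hlen : ∀ m, (hist A i m).length = m + 1 := by
    intro m
    induction m with
    | zero => rfl
    | succ m ih => simp [hist, ih]
  induction m with
  | zero => omega
  | succ m ih =>
    rcases Nat.lt_or_ge m k with h | h
    · obtain rfl : k = m + 1 := by omega
      rw [hist, List.getD_append_right _ _ _ _ (by simp [hlen])]
      simp [hlen]
    · rw [hist, List.getD_append _ _ _ _ (by rw [hlen]; omega), ih h]

theorem hist_congr {A B : Adversary n} {i : Fin n} {m : ℕ}
    (h : ∀ k, 1 ≤ k → k ≤ m → miss A k i = miss B k i) : hist A i m = hist B i m := by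
  induction m with
  | zero => rfl
  | succ m ih =>
    rw [hist, hist, ih fun k h1 hk => h k h1 (by omega), h (m + 1) (by omega) le_rfl]

/-! ### Seen values -/

theorem mem_seen_succ {A : Adversary n} {f : Fin n → Bool} {k : ℕ} {i : Fin n} {w : Bool} :
    w ∈ seen A f (k + 1) i ↔
      w ∈ seen A f k i ∨ ∃ j, A.F (k + 1) j i = true ∧ w ∈ seen A f k j := by
  simp only [seen, mem_union, mem_biUnion, mem_univ, true_and]
  refine or_congr_right (exists_congr fun j => ?_)
  split_ifs with h <;> simp [h]

theorem seen_mono (A : Adversary n) (f : Fin n → Bool) (i : Fin n) :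
    Monotone fun k => seen A f k i :=
  monotone_nat_of_le_succ fun _ _ hw => mem_seen_succ.2 (Or.inl hw)

theorem self_mem_seen (A : Adversary n) (f : Fin n → Bool) (k : ℕ) (i : Fin n) :
    f i ∈ seen A f k i :=
  seen_mono A f i (Nat.zero_le k) (by simp [seen])

theorem exists_of_mem_seen {A : Adversary n} {f : Fin n → Bool} {k : ℕ} {i : Fin n} {w : Bool}
    (h : w ∈ seen A f k i) : ∃ j, f j = w := by
  induction k generalizing i with
  | zero => exact ⟨i, by simpa [seen, eq_comm] using h⟩
  | succ k ih =>
    rcases mem_seen_succ.1 h with h | ⟨j, -, h⟩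
    exacts [ih h, ih h]

theorem eq_univ_of_mem {S : Finset Bool} {a b : Bool} (ha : a ∈ S) (hb : b ∈ S) (h : a ≠ b) :
    S = univ := by
  ext c
  cases a <;> cases b <;> cases c <;> simp_all

theorem seen_eq_singleton_or_univ (A : Adversary n) (f : Fin n → Bool) (k : ℕ) (i : Fin n) :
    seen A f k i = {f i} ∨ seen A f k i = univ := by
  by_cases h : (!f i) ∈ seen A f k i
  · exact Or.inr (eq_univ_of_mem (self_mem_seen A f k i) h (by simp))
  · left
    ext c
    have := self_mem_seen A f k i
    cases hf : f i <;> cases c <;> simp_all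

theorem seen_const (A : Adversary n) (w : Bool) (k : ℕ) (i : Fin n) :
    seen A (fun _ => w) k i = {w} := by
  refine (seen_eq_singleton_or_univ A (fun _ => w) k i).resolve_right fun h => ?_
  obtain ⟨_, hj⟩ := exists_of_mem_seen (w := !w) (h ▸ mem_univ (!w))
  simp at hj

theorem seen_eq_univ {A : Adversary n} {f : Fin n → Bool} {m : ℕ} (hm : 1 ≤ m) {i j : Fin n}
    (hF : A.F 1 j i = true) (hf : f j ≠ f i) : seen A f m i = univ := by
  refine eq_univ_of_mem (seen_mono A f i hm ?_) (self_mem_seen A f m i) hf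
  exact mem_seen_succ.2 (Or.inr ⟨j, hF, by simp [seen]⟩)

theorem seen_succ_of_agree {A : Adversary n} {t : ℕ} (hA : A.Valid t) {f : Fin n → Bool} {m : ℕ}
    (h : ∀ i j, aliveAt A m i → aliveAt A m j → seen A f m i = seen A f m j) {i : Fin n}
    (hi : aliveAt A m i) : seen A f (m + 1) i = seen A f m i := by
  ext w
  rw [mem_seen_succ]
  refine ⟨?_, Or.inl⟩
  rintro (hw | ⟨j, hj, hw⟩)
  · exact hw
  · rwa [h i j hi (hA.aliveAt_of_deliver hj)]

/-- Either all live agents have seen the same values, or there was a crash in every round. -/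
theorem seen_agree_or_le_card_crashed {A : Adversary n} {t : ℕ} (hA : A.Valid t)
    (f : Fin n → Bool) (m : ℕ) :
    (∀ i j, aliveAt A m i → aliveAt A m j → seen A f m i = seen A f m j) ∨
      m ≤ #{i | ¬ aliveAt A m i} := by
  induction m with
  | zero => exact Or.inr (Nat.zero_le _)
  | succ m ih =>
    rcases ih with ih | ih
    · left
      intro i j hi hj
      have hi' := hi.mono (Nat.le_succ m)
      have hj' := hj.mono (Nat.le_succ m)
      rw [seen_succ_of_agree hA ih hi', seen_succ_of_agree hA ih hj', ih i j hi' hj']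
    · by_cases hD : ∀ i, aliveAt A m i → aliveAt A (m + 1) i
      · left
        have key : ∀ i j, aliveAt A (m + 1) i → aliveAt A (m + 1) j →
            seen A f (m + 1) i ⊆ seen A f (m + 1) j := by
          intro i j hi hj w hw
          rw [mem_seen_succ] at hw ⊢
          right
          rcases hw with hw | ⟨l, hl, hw⟩
          · exact ⟨i, hA.deliver_of_aliveAt hi j, hw⟩
          · exact ⟨l, hA.deliver_of_aliveAt (hD l (hA.aliveAt_of_deliver hl)) j, hw⟩
        exact fun i j hi hj => (key i j hi hj).antisymm (key j i hj hi)
      · right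
        push Not at hD
        obtain ⟨l, hl, hl'⟩ := hD
        refine Nat.succ_le_of_lt (ih.trans_lt (card_lt_card ?_))
        refine (ssubset_iff_of_subset ?_).2 ⟨l, by simpa using hl', by simpa using hl⟩
        intro j hj
        simp only [mem_filter, mem_univ, true_and] at hj ⊢
        exact fun h => hj (h.mono (Nat.le_succ m))

theorem seen_agree {A : Adversary n} {t : ℕ} (hA : A.Valid t) (f : Fin n → Bool) {m : ℕ}
    (hm : min (t + 1) (n - 1) ≤ m) {i j : Fin n} (hi : Up A m i) (hj : Up A m j) :
    seen A f m i = seen A f m j := by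
  by_cases hij : i = j
  · rw [hij]
  have hn : 2 ≤ n := by
    have := i.2; have := j.2
    have : (i : ℕ) ≠ j := fun h => hij (Fin.ext h)
    omega
  have hi := hi.resolve_left (by omega)
  have hj := hj.resolve_left (by omega)
  refine (seen_agree_or_le_card_crashed hA f m).elim (fun h => h i j hi hj) fun h => ?_
  have h1 : #{i | ¬ aliveAt A m i} ≤ t := by
    refine le_trans ?_ hA.2.2
    rw [← Set.ncard_coe_finset]
    refine Set.ncard_le_ncard ?_ (Set.toFinite _)
    intro l hl
    simp only [aliveAt, coe_filter, mem_univ, true_and, Set.mem_ofPred_eq, not_forall] at hl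
    obtain ⟨k, -, hk⟩ := hl
    exact ⟨k, l, by simpa using hk⟩
  have h2 : #{i | ¬ aliveAt A m i} ≤ n - 2 := by
    have : #{i | ¬ aliveAt A m i} ≤ #(univ \ {i, j} : Finset (Fin n)) := by
      refine card_le_card fun l hl => ?_
      simp only [mem_filter, mem_univ, true_and] at hl
      simp only [mem_sdiff, mem_univ, true_and, mem_insert, mem_singleton, not_or]
      exact ⟨fun e => hl (e ▸ hi), fun e => hl (e ▸ hj)⟩
    rwa [card_sdiff_of_subset (subset_univ _), card_pair hij, card_univ, Fintype.card_fin] at this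
  omega

theorem eq_of_up_of_miss {A : Adversary n} {t : ℕ} (hA : A.Valid t) {k m : ℕ} (h1 : 1 ≤ k)
    (hk : k ≤ m) {i : Fin n} (hi : Up A m i) (h : n - 1 ≤ miss A k i) {j : Fin n}
    (hj : Up A m j) : j = i := by
  have hi := hi.resolve_left (by omega)
  have hj := hj.resolve_left (by omega)
  by_contra hij
  have : miss A k i ≤ #(univ \ {j, i} : Finset (Fin n)) := by
    refine card_le_card fun l hl => ?_
    simp only [mem_filter, mem_univ, true_and] at hl
    simp only [mem_sdiff, mem_univ, true_and, mem_insert, mem_singleton, not_or]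
    constructor <;> rintro rfl
    · simp [hA.deliver_of_aliveAt (hj.mono hk)] at hl
    · simp [hA.deliver_of_aliveAt (hi.mono hk)] at hl
  rw [card_sdiff_of_subset (subset_univ _), card_pair hij, card_univ, Fintype.card_fin] at this
  have := i.2; have := j.2
  have : (j : ℕ) ≠ i := fun h => hij (Fin.ext h)
  omega

/-! ### Runs -/

theorem stateOf_zero (A : Adversary n) (f : Fin n → Bool) (i : Fin n) :
    stateOf A f 0 i = .live {f i} [0] 0 (f i) := by
  simp [stateOf, Up, seen, hist]

theorem stateOf_of_up {A : Adversary n} {m : ℕ} {i : Fin n} (h : Up A m i) (f : Fin n → Bool) :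
    stateOf A f m i = .live (seen A f m i) (hist A i m) m (f i) := if_pos h

/-- The round update of the exchange, applied to `stateOf`. -/
theorem stateOf_succ {A : Adversary n} {t : ℕ} (hA : A.Valid t) (f : Fin n → Bool)
    (r : Run (countPRE n)) (hr : r.env = A) (k : ℕ) (hk : r.st k = stateOf A f k) (i : Fin n) :
    stateOf A f (k + 1) i =
      if aliveAt r.env (k + 1) i
      then (countPRE n).δ i (r.st k i) r.env (noopProt (countPRE n) i (r.st k i))
        (recvd (countPRE n) (noopProt (countPRE n)) r k i)
      else (countPRE n).crashSt i := by
  subst hr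
  by_cases ha : aliveAt r.env (k + 1) i
  · have hms : recvd (countPRE n) (noopProt (countPRE n)) r k i =
        fun j => if r.env.F (k + 1) j i = true then some (seen r.env f k j) else none := by
      funext j
      by_cases hF : r.env.F (k + 1) j i = true
      · simp only [recvd, hF, if_true, hk,
          stateOf_of_up (Or.inr (hA.aliveAt_of_deliver hF)) f]
        rfl
      · simp only [recvd, hF]
        rfl
    rw [if_pos ha, hms, hk, stateOf_of_up (Or.inr ha),
      stateOf_of_up (Or.inr (ha.mono (Nat.le_succ k)))]
    simp only [countPRE, seen, hist, CountPRState.live.injEq, and_true]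
    refine ⟨?_, ?_⟩
    · congr 1
      refine biUnion_congr rfl fun j _ => ?_
      split_ifs <;> rfl
    · congr 2
      refine congrArg card (filter_congr fun j _ => ?_)
      by_cases hF : r.env.F (k + 1) j i = true <;> simp [hF]
  · rw [if_neg ha, stateOf, if_neg (by simpa [Up] using ha)]
    rfl

theorem runOf_mem_Sys {A : Adversary n} {t : ℕ} (hA : A.Valid t) (f : Fin n → Bool) :
    runOf A f ∈ Sys (countPRE n) t :=
  ⟨hA, fun i => ⟨f i, stateOf_zero A f i⟩, fun k i => stateOf_succ hA f (runOf A f) rfl k rfl i⟩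

theorem exists_eq_runOf {t : ℕ} {r : Run (countPRE n)} (hr : r ∈ Sys (countPRE n) t) :
    r.env.Valid t ∧ ∃ f, r = runOf r.env f := by
  obtain ⟨hA, h0, hs⟩ := hr
  choose f hf using h0
  refine ⟨hA, f, ?_⟩
  have : ∀ k, r.st k = stateOf r.env f k := by
    intro k
    induction k with
    | zero => exact funext fun i => (hf i).trans (stateOf_zero _ f i).symm
    | succ k ih => exact funext fun i => (hs k i).trans (stateOf_succ hA f r rfl k ih i).symm
  obtain ⟨A, st⟩ := r
  exact congrArg (Run.mk A) (funext this)

theorem nonfailed_runOf {A : Adversary n} {f : Fin n → Bool} {m : ℕ} {i : Fin n} :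
    Nonfailed (countPRE n) (runOf A f) m i ↔ Up A m i := by
  simp only [Nonfailed, runOf, stateOf, countPRE]
  split_ifs with h <;> simp [h]

theorem existsVal_runOf {A : Adversary n} {f : Fin n → Bool} {m : ℕ} {w : Bool} :
    ExistsVal (countPRE n) w (runOf A f) m ↔ ∃ i, f i = w := by
  refine exists_congr fun i => ?_
  change stateOf A f 0 i = .live {w} [0] 0 w ↔ _
  rw [stateOf_zero]
  simp

theorem stateOf_inj {A B : Adversary n} {f g : Fin n → Bool} {m m' : ℕ} {i : Fin n}
    (hi : Up A m i) (h : (runOf A f).st m i = (runOf B g).st m' i) :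
    m = m' ∧ Up B m' i ∧ seen A f m i = seen B g m' i ∧ hist A i m = hist B i m' := by
  change stateOf A f m i = stateOf B g m' i at h
  rw [stateOf_of_up hi, stateOf] at h
  split_ifs at h with hB
  injection h with h1 h2 h3 h4
  exact ⟨h3, hB, h1, h2⟩

/-! ### Common knowledge -/

theorem CK_of_invariant {E : InfoExchange n} {R : Set (Run E)} {φ : Form E} (Φ : Form E)
    (hφ : ∀ r m, Φ r m → φ r m)
    (hΦ : ∀ r m i, Φ r m → Nonfailed E r m i → ∀ r' ∈ R, ∀ m', r.st m i = r'.st m' i → Φ r' m')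
    {r : Run E} {m : ℕ} (h : Φ r m) : CK E R φ r m := by
  have key : ∀ k r m, Φ r m → (EvK E R)^[k] φ r m := by
    intro k
    induction k with
    | zero => exact hφ
    | succ k ih =>
      intro r m h
      rw [Function.iterate_succ_apply']
      exact fun i hi r' hr' m' e => ih r' m' (hΦ r m i h hi r' hr' m' e)
  exact fun k => key _ r m h

theorem CK.step {E : InfoExchange n} {R : Set (Run E)} {φ : Form E} {r r' : Run E} {m m' : ℕ}
    (h : CK E R φ r m) {i : Fin n} (hi : Nonfailed E r m i) (hr' : r' ∈ R)
    (e : r.st m i = r'.st m' i) : CK E R φ r' m' := by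
  intro k
  have := h (k + 1)
  rw [Function.iterate_succ_apply'] at this
  exact this i hi r' hr' m' e

theorem CK.holds {E : InfoExchange n} {R : Set (Run E)} {φ : Form E} {r : Run E} {m : ℕ}
    (h : CK E R φ r m) {i : Fin n} (hi : Nonfailed E r m i) (hr : r ∈ R) : φ r m :=
  h 0 i hi r hr m rfl

theorem CK_of_seen {A : Adversary n} {t : ℕ} (hA : A.Valid t) {f : Fin n → Bool} {m : ℕ}
    {i : Fin n} (hi : Up A m i)
    (h : min (t + 1) (n - 1) ≤ m ∨ ∃ k, 1 ≤ k ∧ k ≤ m ∧ n - 1 ≤ miss A k i) :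
    CK (countPRE n) (Sys (countPRE n) t) (ExistsVal (countPRE n) (f i)) (runOf A f) m := by
  rcases h with h | ⟨k, h1, hk, h⟩
  · refine CK_of_invariant (fun r m' => m' = m ∧ ∃ B g, B.Valid t ∧ r = runOf B g ∧
      (∃ j, Up B m j) ∧ ∀ j, Up B m j → f i ∈ seen B g m j) ?_ ?_
      ⟨rfl, A, f, hA, rfl, ⟨i, hi⟩, fun j hj => seen_agree hA f h hi hj ▸ self_mem_seen A f m i⟩
    · rintro _ _ ⟨rfl, B, g, -, rfl, ⟨j, hj⟩, hs⟩
      exact existsVal_runOf.2 (exists_of_mem_seen (hs j hj))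
    · rintro _ _ j ⟨rfl, B, g, -, rfl, -, hs⟩ hj r' hr' m' e
      obtain ⟨hB', g', hr'⟩ := exists_eq_runOf hr'
      rw [hr'] at e
      rw [nonfailed_runOf] at hj
      obtain ⟨rfl, hj', e1, -⟩ := stateOf_inj hj e
      refine ⟨rfl, r'.env, g', hB', hr', ⟨j, hj'⟩, fun l hl => ?_⟩
      rw [seen_agree hB' g' h hl hj', ← e1]
      exact hs j hj
  · refine CK_of_invariant (fun r m' => m' = m ∧ ∃ B g, B.Valid t ∧ r = runOf B g ∧
      Up B m i ∧ f i ∈ seen B g m i ∧ hist A i m = hist B i m) ?_ ?_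
      ⟨rfl, A, f, hA, rfl, hi, self_mem_seen A f m i, rfl⟩
    · rintro _ _ ⟨rfl, B, g, -, rfl, -, hs, -⟩
      exact existsVal_runOf.2 (exists_of_mem_seen hs)
    · rintro _ _ j ⟨rfl, B, g, hB, rfl, hBi, hs, hh⟩ hj r' hr' m' e
      obtain ⟨hB', g', hr'⟩ := exists_eq_runOf hr'
      rw [hr'] at e
      rw [nonfailed_runOf] at hj
      rw [← getD_hist A i h1 hk, hh, getD_hist B i h1 hk] at h
      obtain rfl := eq_of_up_of_miss hB h1 hk hBi h hj
      obtain ⟨rfl, hj', e1, e2⟩ := stateOf_inj hj e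
      exact ⟨rfl, r'.env, g', hB', hr', hj', e1 ▸ hs, hh.trans e2⟩

/-! ### Reachability at a fixed time -/

/-- `Q` is preserved when moving to a point that some nonfailed agent cannot distinguish. -/
def Closed (t m : ℕ) (Q : Adversary n → (Fin n → Bool) → Prop) : Prop :=
  ∀ ⦃A B : Adversary n⦄ ⦃f g : Fin n → Bool⦄ ⦃i : Fin n⦄, A.Valid t → B.Valid t →
    Up A m i → Up B m i → seen A f m i = seen B g m i →
    (∀ k, 1 ≤ k → k ≤ m → miss A k i = miss B k i) → f i = g i → Q A f → Q B g

theorem Closed.imp {t m : ℕ} {Q : Adversary n → (Fin n → Bool) → Prop} (hQ : Closed t m Q)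
    (p : Prop) : Closed t m fun A f => Q A f → p :=
  fun _ _ _ _ _ hA hB hi hi' hs hm hf h hq =>
    h (hQ hB hA hi' hi hs.symm (fun k h1 hk => (hm k h1 hk).symm) hf.symm hq)

theorem closed_CK (t m : ℕ) (φ : Form (countPRE n)) :
    Closed t m fun A f => CK (countPRE n) (Sys (countPRE n) t) φ (runOf A f) m := by
  intro A B f g i hA hB hi hi' hs hm hf h
  refine h.step (nonfailed_runOf.2 hi) (runOf_mem_Sys hB g) ?_
  change stateOf A f m i = stateOf B g m i
  rw [stateOf_of_up hi, stateOf_of_up hi', hs, hist_congr hm, hf]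

/-- The adversary without failures. -/
def noFail (n : ℕ) : Adversary n := ⟨fun _ _ _ => true⟩

theorem noFail_valid (n t : ℕ) : (noFail n).Valid t := by
  simp [Adversary.Valid, noFail]

theorem noFail_up (m : ℕ) (i : Fin n) : Up (noFail n) m i := Or.inr fun _ _ => rfl

theorem miss_noFail (k : ℕ) (i : Fin n) : miss (noFail n) k i = 0 := by
  simp [miss, noFail]

theorem seen_noFail {g : Fin n → Bool} {a b : Fin n} (hg : g a ≠ g b) {m : ℕ} (hm : 1 ≤ m)
    (i : Fin n) : seen (noFail n) g m i = univ := by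
  by_cases h : g a = g i
  · exact seen_eq_univ (j := b) hm rfl (h ▸ hg.symm)
  · exact seen_eq_univ (j := a) hm rfl h

/-- Agents fail in increasing order of `σ`, with `c k` failures up to round `k`; those failing in
a round omit to send to `i` (and to themselves) only. -/
def hideFrom (σ : Fin n ≃ Fin n) (c : ℕ → ℕ) (i : Fin n) : Adversary n :=
  ⟨fun k x y => decide (c k ≤ σ x ∨ (c (k - 1) ≤ σ x ∧ y ≠ i ∧ y ≠ x))⟩

theorem card_perm_lt (σ : Fin n ≃ Fin n) {a : ℕ} (ha : a ≤ n) : #{x | (σ x : ℕ) < a} = a := by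
  have : #{x | (σ x : ℕ) < a} = #{y : Fin n | (y : ℕ) < a} :=
    card_equiv σ (by simp)
  rw [this, Fin.card_filter_val_lt]
  exact min_eq_right ha

theorem hideFrom_valid {σ : Fin n ≃ Fin n} {c : ℕ → ℕ} {i : Fin n} {t : ℕ} (hc : Monotone c)
    (hct : ∀ k, c k ≤ t) : (hideFrom σ c i).Valid t := by
  refine ⟨?_, ?_, ?_⟩
  · intro m x h m' hm' y
    have h1 : c m ≤ c m' := hc hm'.le
    have h2 : c m ≤ c (m' - 1) := hc (by omega)
    simp only [hideFrom, decide_eq_false_iff_not] at h ⊢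
    simp only [ne_eq, not_true, and_false, or_false] at h
    omega
  · intro m x y h
    simp only [hideFrom, decide_eq_false_iff_not] at h ⊢
    simp only [ne_eq, not_true, and_false, or_false]
    exact fun h' => h (Or.inl h')
  · have hsub : {x : Fin n | ∃ m y, (hideFrom σ c i).F m x y = false} ⊆
        (({x | (σ x : ℕ) < min t n} : Finset (Fin n)) : Set (Fin n)) := by
      rintro x ⟨m, y, h⟩
      simp only [hideFrom, decide_eq_false_iff_not] at h
      have := hct m
      have := (σ x).2
      simp only [coe_filter, mem_univ, true_and, Set.mem_ofPred_eq]
      have : ¬ c m ≤ σ x := fun h' => h (Or.inl h')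
      omega
    refine (Set.ncard_le_ncard hsub (Set.toFinite _)).trans ?_
    rw [Set.ncard_coe_finset, card_perm_lt σ (min_le_right _ _)]
    exact min_le_left _ _

theorem hideFrom_up {σ : Fin n ≃ Fin n} {c : ℕ → ℕ} {i j : Fin n} (h : ∀ k, c k ≤ σ j) (m : ℕ) :
    Up (hideFrom σ c i) m j :=
  Or.inr fun k _ => by simp [hideFrom, h k]

theorem miss_hideFrom_self {σ : Fin n ≃ Fin n} {c : ℕ → ℕ} {i : Fin n} (hcn : ∀ k, c k ≤ n)
    (k : ℕ) : miss (hideFrom σ c i) k i = c k := by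
  rw [← card_perm_lt σ (hcn k), miss]
  simp [hideFrom]

theorem miss_hideFrom {σ : Fin n ≃ Fin n} {c : ℕ → ℕ} {i j : Fin n} (hc : Monotone c)
    (hcn : ∀ k, c k ≤ n) (hij : j ≠ i) (hj : ∀ k, c k ≤ σ j) (k : ℕ) :
    miss (hideFrom σ c i) k j = c (k - 1) := by
  rw [← card_perm_lt σ (hcn (k - 1)), miss]
  refine congrArg card (filter_congr fun x _ => ?_)
  have h1 : c (k - 1) ≤ c k := hc (by omega)
  simp only [hideFrom, decide_eq_false_iff_not, ne_eq, hij, not_false_eq_true, true_and]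
  by_cases hx : j = x
  · subst hx
    have := hj k
    omega
  · simp only [hx, not_false_eq_true, and_true]
    omega

/-- `Q` holds at a point where some nonfailed agent has missing-message counts `c`, seen values
`W` and initial value `w`. -/
def HasView (t m : ℕ) (Q : Adversary n → (Fin n → Bool) → Prop) (c : ℕ → ℕ) (W : Finset Bool)
    (w : Bool) : Prop :=
  ∃ A f i, A.Valid t ∧ Up A m i ∧ (∀ k, 1 ≤ k → k ≤ m → miss A k i = c k) ∧
    seen A f m i = W ∧ f i = w ∧ Q A f

theorem HasView.shift {t m : ℕ} {Q : Adversary n → (Fin n → Bool) → Prop} (hQ : Closed t m Q)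
    {c : ℕ → ℕ} (hc : Monotone c) (hct : ∀ k, c k ≤ t) (hcn : ∀ k, c k + 2 ≤ n)
    {W : Finset Bool} {w : Bool} (h : HasView t m Q c W w) :
    ∃ w', HasView t m Q (fun k => c (k - 1)) W w' := by
  obtain ⟨A, f, i, hA, hi, hm, rfl, -, hq⟩ := h
  have hn : 2 ≤ n := (Nat.le_add_left _ _).trans (hcn 0)
  let σ : Fin n ≃ Fin n := Equiv.swap i ⟨n - 1, by omega⟩
  let j : Fin n := σ.symm ⟨n - 2, by omega⟩
  have hσi : (σ i : ℕ) = n - 1 := by simp [σ]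
  have hσj : (σ j : ℕ) = n - 2 := by simp [j]
  have hij : j ≠ i := fun e => by rw [e] at hσj; omega
  have hcn' : ∀ k, c k ≤ n := fun k => by have := hcn k; omega
  have hci : ∀ k, c k ≤ σ i := fun k => by have := hcn k; omega
  have hcj : ∀ k, c k ≤ σ j := fun k => by have := hcn k; omega
  have hB : (hideFrom σ c i).Valid t := hideFrom_valid hc hct
  obtain ⟨g, hgi, hsi, hsj⟩ : ∃ g : Fin n → Bool, f i = g i ∧
      seen A f m i = seen (hideFrom σ c i) g m i ∧
      seen (hideFrom σ c i) g m j = seen A f m i := by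
    rcases seen_eq_singleton_or_univ A f m i with hs | hs
    · exact ⟨fun _ => f i, rfl, by rw [hs, seen_const], by rw [hs, seen_const]⟩
    · have hm1 : 1 ≤ m := by
        by_contra hm0
        obtain rfl : m = 0 := by omega
        have := congrArg card hs
        simp [seen] at this
      have hg : (fun x => if x = i then f i else !f i) j ≠
          (fun x => if x = i then f i else !f i) i := by simp [hij]
      refine ⟨fun x => if x = i then f i else !f i, by simp, ?_, ?_⟩
      · rw [hs, seen_eq_univ hm1 (j := j) (by simp [hideFrom, hcj]) hg]
      · rw [hs, seen_eq_univ hm1 (j := i) (by simp [hideFrom, hci]) hg.symm]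
  refine ⟨g j, hideFrom σ c i, g, j, hB, hideFrom_up hcj m,
    fun k _ _ => miss_hideFrom hc hcn' hij hcj k, hsj, rfl,
    hQ hA hB hi (hideFrom_up hci m) hsi ?_ hgi hq⟩
  intro k h1 hk
  rw [hm k h1 hk, miss_hideFrom_self hcn']

theorem HasView.reset {t m : ℕ} {Q : Adversary n → (Fin n → Bool) → Prop} (hQ : Closed t m Q)
    {c : ℕ → ℕ} (hc : Monotone c) (hc0 : c 0 = 0) (hct : ∀ k, c k ≤ t) (hcn : ∀ k, c k + 2 ≤ n)
    {W : Finset Bool} {w : Bool} (h : HasView t m Q c W w) :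
    ∃ w', HasView t m Q (fun _ => 0) W w' := by
  have key : ∀ s, ∃ w', HasView t m Q (fun k => c (k - s)) W w' := by
    intro s
    induction s with
    | zero => exact ⟨w, h⟩
    | succ s ih =>
      obtain ⟨w', ih⟩ := ih
      obtain ⟨w'', ih⟩ := ih.shift hQ (fun a b hab => hc (by omega)) (fun k => hct _)
        (fun k => hcn _)
      exact ⟨w'', by simpa only [Nat.sub_sub, Nat.add_comm 1 s] using ih⟩
  obtain ⟨w', A, f, i, hA, hi, hm, h⟩ := key m
  refine ⟨w', A, f, i, hA, hi, fun k h1 hk => ?_, h⟩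
  simp only [hm k h1 hk, Nat.sub_eq_zero_of_le hk, hc0]

theorem Closed.noFail_of_noFail {t m : ℕ} {Q : Adversary n → (Fin n → Bool) → Prop}
    (hQ : Closed t m Q) (hm : 1 ≤ m) (hn : 3 ≤ n) {f g : Fin n → Bool} {a b a' b' : Fin n}
    (hf : f a ≠ f b) (hg : g a' ≠ g b') (h : Q (noFail n) f) : Q (noFail n) g := by
  have step : ∀ {f g : Fin n → Bool} {a b a' b' : Fin n} (i : Fin n), f a ≠ f b → g a' ≠ g b' →
      f i = g i → Q (noFail n) f → Q (noFail n) g := fun i hf hg hi =>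
    hQ (noFail_valid n t) (noFail_valid n t) (noFail_up m i) (noFail_up m i)
      (by rw [seen_noFail hf hm, seen_noFail hg hm]) (fun _ _ _ => by simp [miss_noFail]) hi
  let x : Fin n := ⟨0, by omega⟩
  let y : Fin n := ⟨1, by omega⟩
  let z : Fin n := ⟨2, by omega⟩
  let e : Fin n → Bool := fun l => if l = x then f x else if l = y then g y else !f x
  have hyx : y ≠ x := by simp [x, y]
  have hzx : z ≠ x := by simp [x, z]
  have hzy : z ≠ y := by simp [y, z]
  have he : e x ≠ e z := by simp [e, hzx, hzy]
  exact step y he hg (by simp [e, hyx]) (step x hf he (by simp [e]) h)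

/-- From a point where some agent never missed `n - 1` messages, the failure-free points with
the same set of values seen can be reached. -/
theorem Closed.noFail {t m : ℕ} {Q : Adversary n → (Fin n → Bool) → Prop} (hQ : Closed t m Q)
    (hmn : m + 2 ≤ n) {A : Adversary n} {f : Fin n → Bool} {i : Fin n} (hA : A.Valid t)
    (hi : Up A m i) (hmiss : ∀ k, 1 ≤ k → k ≤ m → miss A k i + 2 ≤ n) (h : Q A f) :
    (∀ w, seen A f m i = {w} → Q (SBA.noFail n) fun _ => w) ∧
    (seen A f m i = univ → ∀ g a b, g a ≠ g b → Q (SBA.noFail n) g) := by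
  let c : ℕ → ℕ := fun k => if 1 ≤ k ∧ 1 ≤ m then miss A (min k m) i else 0
  have hview : HasView t m Q c (seen A f m i) (f i) := by
    refine ⟨A, f, i, hA, hi, fun k h1 hk => ?_, rfl, rfl, h⟩
    simp only [c]
    rw [if_pos ⟨h1, h1.trans hk⟩, min_eq_left hk]
  have hmono : Monotone c := by
    intro a b hab
    simp only [c]
    split_ifs
    · exact miss_mono hA i (by omega)
    · omega
    · exact Nat.zero_le _
    · exact le_rfl
  have hct : ∀ k, c k ≤ t := by
    intro k
    simp only [c]
    split_ifs
    · exact miss_le hA _ i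
    · exact Nat.zero_le t
  have hcn : ∀ k, c k + 2 ≤ n := by
    intro k
    simp only [c]
    split_ifs
    · exact hmiss _ (by omega) (by omega)
    · omega
  obtain ⟨w', B, g, j, hB, hj, hmj, hsj, -, hq⟩ := hview.reset hQ hmono (by simp [c]) hct hcn
  have hmj' : ∀ k, 1 ≤ k → k ≤ m → miss B k j = miss (SBA.noFail n) k j := fun k h1 hk => by
    rw [hmj k h1 hk, miss_noFail]
  constructor
  · intro w hw
    refine hQ hB (noFail_valid n t) hj (noFail_up m j) (by rw [hsj, hw, seen_const]) hmj' ?_ hq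
    have := self_mem_seen B g m j
    rw [hsj, hw] at this
    exact mem_singleton.1 this
  · intro hw g' a b hg'
    have hm1 : 1 ≤ m := by
      by_contra hm0
      obtain rfl : m = 0 := by omega
      have := congrArg card hw
      simp [seen] at this
    obtain ⟨l, hl⟩ : ∃ l : Fin n, l ≠ j := by
      have : Nontrivial (Fin n) := Fin.nontrivial_iff_two_le.2 (by omega)
      exact exists_ne j
    let e : Fin n → Bool := fun x => if x = j then g j else !g j
    have he : e l ≠ e j := by simp [e, hl]
    refine hQ.noFail_of_noFail hm1 (by omega) he hg' ?_
    exact hQ hB (noFail_valid n t) hj (noFail_up m j) (by rw [hsj, hw, seen_noFail he hm1])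
      hmj' (by simp [e]) hq

/-- Agent `x < m` crashes in round `x + 1`, in which its only message delivered is the one to
agent `x + 1`. -/
def chain (n m : ℕ) : Adversary n :=
  ⟨fun k x y => decide (m ≤ (x : ℕ) ∨ k ≤ (x : ℕ) ∨ (k = (x : ℕ) + 1 ∧ (y : ℕ) = x + 1))⟩

theorem chain_valid {m t : ℕ} (hmt : m ≤ t) (hmn : m ≤ n) : (chain n m).Valid t := by
  refine ⟨?_, ?_, ?_⟩
  · intro k x h k' hk' y
    simp only [chain, decide_eq_false_iff_not] at h ⊢
    omega
  · intro k x y h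
    simp only [chain, decide_eq_false_iff_not] at h ⊢
    omega
  · have hsub : {x : Fin n | ∃ k y, (chain n m).F k x y = false} ⊆
        (({x | (x : ℕ) < m} : Finset (Fin n)) : Set (Fin n)) := by
      rintro x ⟨k, y, h⟩
      simp only [chain, decide_eq_false_iff_not] at h
      simp only [coe_filter, mem_univ, true_and, Set.mem_ofPred_eq]
      omega
    refine (Set.ncard_le_ncard hsub (Set.toFinite _)).trans ?_
    rw [Set.ncard_coe_finset, Fin.card_filter_val_lt]
    omega

theorem chain_up {m : ℕ} {i : Fin n} (hi : m ≤ i) : Up (chain n m) m i :=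
  Or.inr fun k _ => by simp [chain, hi]

theorem miss_chain {m k : ℕ} (i : Fin n) : miss (chain n m) k i ≤ m := by
  have : miss (chain n m) k i ≤ #{x : Fin n | (x : ℕ) < m} := by
    refine card_le_card fun x hx => ?_
    simp only [mem_filter, mem_univ, true_and, chain, decide_eq_false_iff_not] at hx ⊢
    omega
  rw [Fin.card_filter_val_lt] at this
  omega

theorem mem_seen_chain {m : ℕ} {f : Fin n → Bool} {w : Bool}
    (h0 : ∀ x : Fin n, (x : ℕ) = 0 → f x = w) {k : ℕ} (x : Fin n) (hx : (x : ℕ) = k) :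
    w ∈ seen (chain n m) f k x := by
  induction k generalizing x with
  | zero => simp [seen, h0 x hx]
  | succ k ih =>
    refine mem_seen_succ.2 (Or.inr ⟨⟨k, by have := x.2; omega⟩, ?_, ih _ rfl⟩)
    simp [chain, hx]

theorem notMem_seen_chain {m : ℕ} {f : Fin n → Bool} {w : Bool}
    (h0 : ∀ x : Fin n, (x : ℕ) ≠ 0 → f x ≠ w) {k : ℕ} (hk : k ≤ m) (x : Fin n) (hx : k < x) :
    w ∉ seen (chain n m) f k x := by
  induction k generalizing x with
  | zero => simpa [seen, eq_comm] using h0 x (by omega)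
  | succ k ih =>
    rw [mem_seen_succ]
    rintro (h | ⟨y, hy, h⟩)
    · exact ih (by omega) x (by omega) h
    · simp only [chain, decide_eq_true_eq] at hy
      exact ih (by omega) y (by omega) h

theorem Closed.chain_of_const {t m : ℕ} {Q : Adversary n → (Fin n → Bool) → Prop}
    (hQ : Closed t m Q) (hmt : m ≤ t) (hmn : m + 2 ≤ n) (w : Bool)
    (h : Q (SBA.noFail n) fun _ => w) :
    Q (chain n m) fun x => if (x : ℕ) = 0 then !w else w := by
  refine ((hQ.imp _).noFail (i := ⟨m + 1, by omega⟩) hmn (chain_valid hmt (by omega))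
    (chain_up (by simp)) (fun k _ _ => ?_) id).1 w ?_ h
  · have := miss_chain (m := m) (k := k) (⟨m + 1, by omega⟩ : Fin n)
    omega
  · have hn : (!w) ∉ seen (chain n m) (fun x => if (x : ℕ) = 0 then !w else w) m
        ⟨m + 1, by omega⟩ :=
      notMem_seen_chain (by intro x hx; simp [hx]) le_rfl _ (by simp)
    rcases seen_eq_singleton_or_univ (chain n m) (fun x => if (x : ℕ) = 0 then !w else w) m
        ⟨m + 1, by omega⟩ with hs | hs
    · simpa using hs
    · exact absurd (hs ▸ mem_univ _) hn

/-- Before the clean-round bound, the points where all values are equal and nobody fails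
are connected with each other and with the mixed failure-free points. -/
theorem Closed.noFail_of_const {t m : ℕ} {Q : Adversary n → (Fin n → Bool) → Prop}
    (hQ : Closed t m Q) (hmt : m ≤ t) (hmn : m + 2 ≤ n) (w : Bool)
    (h : Q (SBA.noFail n) fun _ => w) :
    (m = 0 → Q (SBA.noFail n) fun _ => !w) ∧
    (1 ≤ m → ∀ g a b, g a ≠ g b → Q (SBA.noFail n) g) := by
  have := hQ.chain_of_const hmt hmn w h
  have hmem : (!w) ∈ seen (chain n m) (fun x => if (x : ℕ) = 0 then !w else w) m
      ⟨m, by omega⟩ := mem_seen_chain (by intro x hx; simp [hx]) _ rfl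
  have h2 := hQ.noFail (i := ⟨m, by omega⟩) hmn (chain_valid hmt (by omega))
    (chain_up (by simp)) (fun k _ _ => by
      have := miss_chain (m := m) (k := k) (⟨m, by omega⟩ : Fin n)
      omega) this
  constructor
  · rintro rfl
    exact h2.1 _ (by simp [seen])
  · intro hm
    refine h2.2 (eq_univ_of_mem hmem (self_mem_seen _ _ _ _) ?_)
    simp [show m ≠ 0 by omega]

theorem Closed.const_of_mixed {t m : ℕ} {Q : Adversary n → (Fin n → Bool) → Prop}
    (hQ : Closed t m Q) (hmt : m ≤ t) (hmn : m + 2 ≤ n) (hm : 1 ≤ m) (w : Bool)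
    {g : Fin n → Bool} {a b : Fin n} (hg : g a ≠ g b) (h : Q (SBA.noFail n) g) :
    Q (SBA.noFail n) fun _ => w :=
  ((hQ.imp _).noFail_of_const hmt hmn w id).2 hm g a b hg h

theorem Closed.const {t m : ℕ} {Q : Adversary n → (Fin n → Bool) → Prop} (hQ : Closed t m Q)
    (hmt : m ≤ t) (hmn : m + 2 ≤ n) {A : Adversary n} {f : Fin n → Bool} {i : Fin n}
    (hA : A.Valid t) (hi : Up A m i) (hmiss : ∀ k, 1 ≤ k → k ≤ m → miss A k i + 2 ≤ n)
    (h : Q A f) (w : Bool) : Q (SBA.noFail n) fun _ => w := by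
  have h1 := hQ.noFail hmn hA hi hmiss h
  let g : Fin n → Bool := fun x => decide ((x : ℕ) = 0)
  have hg : g ⟨0, by omega⟩ ≠ g ⟨1, by omega⟩ := by simp [g]
  rcases seen_eq_singleton_or_univ A f m i with hs | hs
  · have h2 := h1.1 _ hs
    by_cases hw : w = f i
    · rwa [hw]
    · have h3 := hQ.noFail_of_const hmt hmn _ h2
      rcases Nat.eq_zero_or_pos m with hm | hm
      · have : w = !f i := by cases w <;> cases hf : f i <;> simp_all
        rw [this]
        exact h3.1 hm
      · exact hQ.const_of_mixed hmt hmn hm w hg (h3.2 hm g _ _ hg)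
  · have hm : 1 ≤ m := by
      by_contra hm0
      obtain rfl : m = 0 := by omega
      have := congrArg card hs
      simp [seen] at this
    exact hQ.const_of_mixed hmt hmn hm w hg (h1.2 hs g _ _ hg)

theorem not_CK {A : Adversary n} {t m : ℕ} (hmt : m ≤ t) (hmn : m + 2 ≤ n) (hA : A.Valid t)
    {f : Fin n → Bool} {i : Fin n} (hi : Up A m i)
    (hmiss : ∀ k, 1 ≤ k → k ≤ m → miss A k i + 2 ≤ n) (w : Bool) :
    ¬ CK (countPRE n) (Sys (countPRE n) t) (ExistsVal (countPRE n) w) (runOf A f) m := by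
  intro h
  have := (closed_CK t m (ExistsVal (countPRE n) w)).const hmt hmn hA hi hmiss h (!w)
  obtain ⟨_, hw⟩ := existsVal_runOf.1
    (this.holds (nonfailed_runOf.2 (noFail_up m i)) (runOf_mem_Sys (noFail_valid n t) _))
  simp at hw

end

/-- in the interpreted system of Counting FloodSet with
perfect recall `E^{count(pr)}` under `Crash_t`, if agent `i`'s local state at
`(r,m)` is `⟨W, h, m, v⟩` with `h` the vector of per-round missing-message
counts, then `C_N(∃0) ∨ C_N(∃1)` holds at `(r,m)` iff `m ≥ min {t+1, n-1}` or
`h[k] ≥ n-1` for some `1 ≤ k ≤ m`. -/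
theorem countPR_common_knowledge_iff
    {n t : ℕ} (ht : t < n) (r : Run (countPRE n)) (hr : r ∈ Sys (countPRE n) t)
    (m : ℕ) (i : Fin n) (W : Finset Bool) (h : List ℕ) (v : Bool)
    (hst : r.st m i = CountPRState.live W h m v) :
    (CK (countPRE n) (Sys (countPRE n) t) (ExistsVal (countPRE n) false) r m ∨
     CK (countPRE n) (Sys (countPRE n) t) (ExistsVal (countPRE n) true) r m)
    ↔ (min (t+1) (n-1) ≤ m ∨ ∃ k, 1 ≤ k ∧ k ≤ m ∧ n-1 ≤ h.getD k 0) := by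
  obtain ⟨hA, f, hf⟩ := exists_eq_runOf hr
  have hi : Up r.env m i := by
    rw [← nonfailed_runOf (f := f), ← hf, Nonfailed, hst]
    exact fun h => CountPRState.noConfusion h
  have hh : h = hist r.env i m := by
    rw [hf] at hst
    have := (stateOf_of_up hi f).symm.trans hst
    injection this with _ h2
    exact h2.symm
  have hmiss : (∃ k, 1 ≤ k ∧ k ≤ m ∧ n - 1 ≤ h.getD k 0) ↔
      ∃ k, 1 ≤ k ∧ k ≤ m ∧ n - 1 ≤ miss r.env k i :=
    exists_congr fun k => and_congr_right fun h1 => and_congr_right fun hk => by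
      rw [hh, getD_hist _ _ h1 hk]
  rw [hmiss]
  constructor
  · intro hck
    by_contra hc
    push Not at hc
    obtain ⟨hm, hc⟩ := hc
    have hmt : m ≤ t := by omega
    have hmn : m + 2 ≤ n := by omega
    have hc' : ∀ k, 1 ≤ k → k ≤ m → miss r.env k i + 2 ≤ n := fun k h1 hk => by
      have := hc k h1 hk
      omega
    rw [hf] at hck
    exact hck.elim (not_CK hmt hmn hA hi hc' _) (not_CK hmt hmn hA hi hc' _)
  · intro hR
    have := CK_of_seen hA (f := f) hi hR
    rw [← hf] at this
    cases hfi : f i <;> rw [hfi] at this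
    exacts [Or.inl this, Or.inr this]

end SBA
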